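/- arXiv:2211.01357 — 8 statements merged into one kernel-verified Lean document; each statement's English description precedes it below -/
import Mathlib

section
/- Let d ≥ 1 be an integer, η > 0, and let Ψ(x) = −ηd·ln(1−‖x‖²) for x in the open Euclidean unit ball of ℝ^d, with Hessian ∇²Ψ(w) = 2ηd·( I/(1−‖w‖²) + 2wwᵀ/(1−‖w‖²)² ). Then for every w, u ∈ ℝ^d with ‖w‖ < 1 and ‖u‖ ≤ 1: (1/(ηd))·(w−u)ᵀ∇²Ψ(w)(w−u) ≥ (‖w‖² − ‖u‖²)² / (1−‖w‖²)². -/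
open Finset
open scoped InnerProductSpace

noncomputable section

/-- The outer product `v wᵀ` of two vectors in `ℝ^d`. -/
def outer {d : ℕ} (v w : EuclideanSpace ℝ (Fin d)) : Matrix (Fin d) (Fin d) ℝ :=
  fun i j => v i * w j

/-- The Hessian of the scaled log-barrier `Ψ(x) = -ηd ln(1-‖x‖²)` of the unit ball:
`∇²Ψ(w) = 2ηd·( I/(1−‖w‖²) + 2wwᵀ/(1−‖w‖²)² )`. -/
def hessPsi (d : ℕ) (η : ℝ) (x : EuclideanSpace ℝ (Fin d)) : Matrix (Fin d) (Fin d) ℝ :=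
  (2 * η * d / (1 - ‖x‖ ^ 2)) • (1 : Matrix (Fin d) (Fin d) ℝ)
    + (4 * η * d / (1 - ‖x‖ ^ 2) ^ 2) • outer x x

/-- The quadratic form `vᵀ M v`. -/
def qf {d : ℕ} (M : Matrix (Fin d) (Fin d) ℝ) (v : EuclideanSpace ℝ (Fin d)) : ℝ :=
  ∑ i, ∑ j, v i * M i j * v j

theorem qf_hessPsi (d : ℕ) (η : ℝ) (x v : EuclideanSpace ℝ (Fin d)) :
    qf (hessPsi d η x) v =
      2 * η * d / (1 - ‖x‖ ^ 2) * ‖v‖ ^ 2 +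
        4 * η * d / (1 - ‖x‖ ^ 2) ^ 2 * ⟪x, v⟫_ℝ ^ 2 := by
  have hinner : ⟪x, v⟫_ℝ = ∑ i, v i * x i := by
    simp [PiLp.inner_apply]
  rw [hinner, EuclideanSpace.real_norm_sq_eq v, sq (∑ i, v i * x i), Finset.sum_mul_sum,
    Finset.mul_sum, Finset.mul_sum, ← Finset.sum_add_distrib]
  refine Finset.sum_congr rfl fun i _ => ?_
  simp only [hessPsi, outer, Matrix.add_apply, Matrix.smul_apply, Matrix.one_apply, smul_eq_mul,
    mul_add, add_mul, Finset.sum_add_distrib, mul_ite, ite_mul, mul_one, mul_zero, zero_mul,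
    Finset.sum_ite_eq, Finset.mem_univ, if_true, Finset.mul_sum]
  congr 1
  · ring
  · exact Finset.sum_congr rfl fun j _ => by ring

/-- For every `w` in the open unit ball and `u` in the closed unit ball,
`(1/(ηd))·(w−u)ᵀ∇²Ψ(w)(w−u) ≥ (‖w‖² − ‖u‖²)² / (1−‖w‖²)²`. -/
theorem log_barrier_hessian_quadratic_lower_bound
    (d : ℕ) (hd : 1 ≤ d) (η : ℝ) (hη : 0 < η)
    (w u : EuclideanSpace ℝ (Fin d)) (hw : ‖w‖ < 1) (hu : ‖u‖ ≤ 1) :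
    (1 / (η * d)) * qf (hessPsi d η w) (w - u) ≥
      (‖w‖ ^ 2 - ‖u‖ ^ 2) ^ 2 / (1 - ‖w‖ ^ 2) ^ 2 := by
  have hd_pos : (0 : ℝ) < d := by exact_mod_cast hd
  have ha : 0 < 1 - ‖w‖ ^ 2 := by nlinarith [norm_nonneg w]
  have hu_sq : ‖u‖ ^ 2 ≤ 1 := by nlinarith [norm_nonneg u]
  have hexpand : ‖u‖ ^ 2 = ‖w‖ ^ 2 - 2 * ⟪w, w - u⟫_ℝ + ‖w - u‖ ^ 2 := by
    simpa using norm_sub_sq_real w (w - u)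
  have hq : 0 ≤ ‖w - u‖ ^ 2 := sq_nonneg _
  have hform : (1 / (η * d)) * qf (hessPsi d η w) (w - u) =
      (2 * ‖w - u‖ ^ 2 * (1 - ‖w‖ ^ 2) + 4 * ⟪w, w - u⟫_ℝ ^ 2) / (1 - ‖w‖ ^ 2) ^ 2 := by
    rw [qf_hessPsi]
    field_simp
  rw [hform, ge_iff_le]
  gcongr
  have hkey : 0 ≤ 2 * (1 - ‖w‖ ^ 2) + 4 * ⟪w, w - u⟫_ℝ - ‖w - u‖ ^ 2 := by linarith
  rw [hexpand]
  nlinarith [mul_nonneg hq hkey]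
end
end

section
/- For every 1 ≤ t ≤ T+1, the function Φ_t is infinitely differentiable on int B(1) and is self-concordant with constant 1/√(dη): for every x ∈ int B(1) and every u ∈ ℝ^d, the third derivative of Φ_t at x, evaluated as a trilinear form at (u,u,u), satisfies |D³Φ_t(x)[u,u,u]| ≤ (2/√(dη))·(uᵀ∇²Φ_t(x)u)^{3/2}. -/
open Finset
open scoped InnerProductSpace

noncomputable section

/-- `Ψ(x) = −ηd·ln(1−‖x‖²)`, the scaled log-barrier of the Euclidean unit ball. -/
def Psi (d : ℕ) (η : ℝ) (x : EuclideanSpace ℝ (Fin d)) : ℝ :=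
  -(η * d) * Real.log (1 - ‖x‖ ^ 2)

/-- `Φ_t(x) = Ψ(x) + ((d+B²η)/2)‖x‖² + (β/2)·Σ_{s=1}^{t−1}⟪g_s, x−w_s⟫² + ⟪x, Σ_{s=1}^{t−1} g_s⟫`. -/
def Phi (d : ℕ) (η β B : ℝ) (g w : ℕ → EuclideanSpace ℝ (Fin d)) (t : ℕ)
    (x : EuclideanSpace ℝ (Fin d)) : ℝ :=
  Psi d η x + ((d + B ^ 2 * η) / 2) * ‖x‖ ^ 2
    + (β / 2) * ∑ s ∈ Icc 1 (t - 1), ⟪g s, x - w s⟫_ℝ ^ 2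
    + ⟪x, (∑ s ∈ Icc 1 (t - 1), g s)⟫_ℝ

/-- The Hessian of `Φ_t`:
`∇²Φ_t(x) = (2ηd/(1−‖x‖²))I + (4ηd/(1−‖x‖²)²)xxᵀ + (d+ηB²)I + β·Σ_{s=1}^{t−1} g_s g_sᵀ`. -/
def hessPhi (d : ℕ) (η β B : ℝ) (g : ℕ → EuclideanSpace ℝ (Fin d)) (t : ℕ)
    (x : EuclideanSpace ℝ (Fin d)) : Matrix (Fin d) (Fin d) ℝ :=
  hessPsi d η x + ((d : ℝ) + η * B ^ 2) • (1 : Matrix (Fin d) (Fin d) ℝ)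
    + β • ∑ s ∈ Icc 1 (t - 1), outer (g s) (g s)

/-- The diagonal of an iterated Fréchet derivative is an iterated derivative along a line. -/
theorem iteratedFDeriv_diag_eq_iteratedDeriv_line {E F : Type*}
    [NormedAddCommGroup E] [NormedSpace ℝ E] [NormedAddCommGroup F] [NormedSpace ℝ F]
    {f : E → F} {U : Set E} {n : ℕ} (hU : IsOpen U) (hf : ContDiffOn ℝ n f U)
    {x : E} (hx : x ∈ U) (u : E) :
    iteratedFDeriv ℝ n f x (fun _ => u) = iteratedDeriv n (fun s : ℝ => f (x + s • u)) 0 := by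
  set L : ℝ →L[ℝ] E := ContinuousLinearMap.toSpanSingleton ℝ u with hL
  set V : Set E := (fun y => x + y) ⁻¹' U
  have hV : IsOpen V := hU.preimage (by fun_prop)
  have hfV : ContDiffOn ℝ n (fun y => f (x + y)) V :=
    hf.comp (by fun_prop) (fun y hy => hy)
  have hLV : IsOpen (L ⁻¹' V) := hV.preimage L.continuous
  have h0 : L 0 ∈ V := by simpa [V] using hx
  have key := L.iteratedFDerivWithin_comp_right hfV hV.uniqueDiffOn hLV.uniqueDiffOn h0 le_rfl
  rw [iteratedFDerivWithin_of_isOpen n hV h0, iteratedFDerivWithin_of_isOpen n hLV h0,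
    iteratedFDeriv_comp_add_left] at key
  have := congrArg (fun M => M (fun _ => (1 : ℝ))) key
  simpa [hL, iteratedDeriv_eq_iteratedFDeriv, Function.comp_def] using this.symm

/-- The third derivative at `0` of a quadratic polynomial minus `c` times the logarithm of another
quadratic polynomial. -/
theorem iteratedDeriv_three_neg_log_quadratic (c r p m a b e : ℝ) (hr : r ≠ 0) :
    iteratedDeriv 3
        (fun s : ℝ => -c * Real.log (r + p * s + m * s ^ 2) + (a + b * s + e * s ^ 2)) 0 =
      -c * (2 * (p / r) ^ 3 - 6 * (p / r) * (m / r)) := by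
  set q : ℝ → ℝ := fun s => r + p * s + m * s ^ 2 with hq
  have hq' : ∀ s, HasDerivAt q (p + 2 * m * s) s := fun s => by
    have := (((hasDerivAt_id s).const_mul p).const_add r).add
      (((hasDerivAt_id s).pow 2).const_mul m)
    refine this.congr_deriv ?_
    simp; ring
  have hl : ∀ s, HasDerivAt (fun s : ℝ => p + 2 * m * s) (2 * m) s := fun s => by
    simpa using ((hasDerivAt_id s).const_mul (2 * m)).const_add p
  have hne : ∀ᶠ s in nhds (0 : ℝ), q s ≠ 0 := by
    refine (hq' 0).continuousAt.eventually_ne ?_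
    simpa [hq] using hr
  have h1 : deriv (fun s : ℝ => -c * Real.log (q s) + (a + b * s + e * s ^ 2)) =ᶠ[nhds 0]
      fun s => -c * ((p + 2 * m * s) / q s) + (b + 2 * e * s) := by
    filter_upwards [hne] with s hs
    have hpoly : HasDerivAt (fun s : ℝ => a + b * s + e * s ^ 2) (b + 2 * e * s) s := by
      have := (((hasDerivAt_id s).const_mul b).const_add a).add
        (((hasDerivAt_id s).pow 2).const_mul e)
      refine this.congr_deriv ?_
      simp; ring
    exact ((((hq' s).log hs).const_mul (-c)).add hpoly).deriv
  have h2 : deriv (fun s => -c * ((p + 2 * m * s) / q s) + (b + 2 * e * s)) =ᶠ[nhds 0]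
      fun s => -c * ((2 * m * q s - (p + 2 * m * s) * (p + 2 * m * s)) / q s ^ 2) + 2 * e := by
    filter_upwards [hne] with s hs
    have hlin : HasDerivAt (fun s : ℝ => b + 2 * e * s) (2 * e) s := by
      simpa using ((hasDerivAt_id s).const_mul (2 * e)).const_add b
    exact ((((hl s).div (hq' s) hs).const_mul (-c)).add hlin).deriv
  have h3 := ((((((hq' 0).const_mul (2 * m)).sub ((hl 0).mul (hl 0))).div ((hq' 0).pow 2)
    (by simpa [hq] using hr)).const_mul (-c)).add_const (2 * e)).deriv
  rw [iteratedDeriv_succ', iteratedDeriv_succ', iteratedDeriv_one]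
  refine ((h1.deriv.trans h2).deriv_eq.trans h3).trans ?_
  simp [hq, -mul_eq_mul_left_iff]
  field_simp
  ring

/-- The scalar inequality behind the self-concordance of `-log` of a concave quadratic. -/
theorem abs_cubic_le_rpow {c y z Q : ℝ} (hc : 0 < c) (hz : 0 ≤ z) (hQ : c * (z + y ^ 2) ≤ Q) :
    |c * (3 * y * z + 2 * y ^ 3)| ≤ 2 / √c * Q ^ ((3 : ℝ) / 2) := by
  set h := z + y ^ 2 with hh
  have h0 : 0 ≤ h := by positivity
  have hch : 0 ≤ c * h := by positivity
  have hcub : |3 * y * z + 2 * y ^ 3| ≤ 2 * (h * √h) := by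
    refine abs_le_of_sq_le_sq ?_ (by positivity)
    rw [mul_pow, mul_pow, Real.sq_sqrt h0, hh]
    nlinarith [mul_nonneg (sq_nonneg z) (sq_nonneg y), pow_nonneg hz 3]
  have hpow : (c * h) ^ ((3 : ℝ) / 2) = c * h * (√c * √h) := by
    rw [show (3 : ℝ) / 2 = 1 + 1 / 2 by norm_num, Real.rpow_add_of_nonneg hch (by norm_num)
      (by norm_num), Real.rpow_one, ← Real.sqrt_eq_rpow, Real.sqrt_mul hc.le]
  have hsc : 0 < √c := Real.sqrt_pos.2 hc
  calc |c * (3 * y * z + 2 * y ^ 3)| = c * |3 * y * z + 2 * y ^ 3| := by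
        rw [abs_mul, abs_of_pos hc]
    _ ≤ c * (2 * (h * √h)) := by gcongr
    _ = 2 / √c * (c * h) ^ ((3 : ℝ) / 2) := by rw [hpow]; field_simp
    _ ≤ 2 / √c * Q ^ ((3 : ℝ) / 2) := by gcongr

section QuadraticForm

variable {d : ℕ} (M N : Matrix (Fin d) (Fin d) ℝ) (u v : EuclideanSpace ℝ (Fin d))

theorem qf_add : qf (M + N) u = qf M u + qf N u := by
  simp [qf, mul_add, add_mul, Finset.sum_add_distrib]

theorem qf_smul (a : ℝ) : qf (a • M) u = a * qf M u := by
  simp only [qf, Matrix.smul_apply, smul_eq_mul, Finset.mul_sum]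
  exact Finset.sum_congr rfl fun i _ => Finset.sum_congr rfl fun j _ => by ring

theorem qf_sum {ι : Type*} (S : Finset ι) (A : ι → Matrix (Fin d) (Fin d) ℝ) :
    qf (∑ s ∈ S, A s) u = ∑ s ∈ S, qf (A s) u := by
  classical
  induction S using Finset.induction_on with
  | empty => simp [qf]
  | insert a S ha ih => rw [Finset.sum_insert ha, Finset.sum_insert ha, qf_add, ih]

theorem qf_one : qf (1 : Matrix (Fin d) (Fin d) ℝ) u = ‖u‖ ^ 2 := by
  rw [EuclideanSpace.real_norm_sq_eq]
  simp [qf, Matrix.one_apply, sq]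

theorem qf_outer : qf (outer v v) u = ⟪v, u⟫_ℝ ^ 2 := by
  simp only [qf, outer, PiLp.inner_apply, sq, Finset.sum_mul_sum]
  refine Finset.sum_congr rfl fun i _ => Finset.sum_congr rfl fun j _ => ?_
  simp
  ring

end QuadraticForm

theorem contDiffOn_Phi (d : ℕ) (η β B : ℝ) (g w : ℕ → EuclideanSpace ℝ (Fin d)) (t : ℕ)
    (n : WithTop ℕ∞) :
    ContDiffOn ℝ n (Phi d η β B g w t) (Metric.ball (0 : EuclideanSpace ℝ (Fin d)) 1) := by
  have hnorm : ContDiff ℝ n fun x : EuclideanSpace ℝ (Fin d) => ‖x‖ ^ 2 := contDiff_norm_sq ℝ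
  have hlog : ContDiffOn ℝ n (fun x : EuclideanSpace ℝ (Fin d) => Real.log (1 - ‖x‖ ^ 2))
      (Metric.ball 0 1) := by
    refine (contDiff_const.sub hnorm).contDiffOn.log fun x hx => ?_
    have hx' : ‖x‖ < 1 := by simpa using hx
    nlinarith [norm_nonneg x]
  unfold Phi Psi
  refine (((contDiffOn_const.mul hlog).add (contDiffOn_const.mul hnorm.contDiffOn)).add ?_).add ?_
  · refine contDiffOn_const.mul (ContDiff.contDiffOn (ContDiff.sum fun s _ => ?_))
    exact (contDiff_const.inner ℝ (contDiff_id.sub contDiff_const)).pow 2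
  · exact (contDiff_id.inner ℝ contDiff_const).contDiffOn

/-- Along a line, `Φ_t` is a quadratic polynomial plus the logarithmic barrier. -/
theorem exists_Phi_line_eq (d : ℕ) (η β B : ℝ) (g w : ℕ → EuclideanSpace ℝ (Fin d)) (t : ℕ)
    (x u : EuclideanSpace ℝ (Fin d)) :
    ∃ a b e : ℝ, (fun s : ℝ => Phi d η β B g w t (x + s • u)) = fun s =>
      -(η * d) * Real.log (1 - ‖x‖ ^ 2 + -(2 * ⟪x, u⟫_ℝ) * s + -‖u‖ ^ 2 * s ^ 2)
        + (a + b * s + e * s ^ 2) := by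
  have hnorm : ∀ s : ℝ, ‖x + s • u‖ ^ 2 = ‖x‖ ^ 2 + 2 * ⟪x, u⟫_ℝ * s + ‖u‖ ^ 2 * s ^ 2 := by
    intro s
    rw [norm_add_sq_real, norm_smul, inner_smul_right, mul_pow, Real.norm_eq_abs, sq_abs]
    ring
  have hsum : ∀ s : ℝ, ∑ k ∈ Icc 1 (t - 1), ⟪g k, x + s • u - w k⟫_ℝ ^ 2 =
      ∑ k ∈ Icc 1 (t - 1), ⟪g k, x - w k⟫_ℝ ^ 2
        + (∑ k ∈ Icc 1 (t - 1), 2 * ⟪g k, x - w k⟫_ℝ * ⟪g k, u⟫_ℝ) * s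
        + (∑ k ∈ Icc 1 (t - 1), ⟪g k, u⟫_ℝ ^ 2) * s ^ 2 := by
    intro s
    rw [Finset.sum_mul, Finset.sum_mul, ← Finset.sum_add_distrib, ← Finset.sum_add_distrib]
    refine Finset.sum_congr rfl fun k _ => ?_
    rw [show x + s • u - w k = (x - w k) + s • u by abel, inner_add_right, inner_smul_right]
    ring
  set G := ∑ k ∈ Icc 1 (t - 1), g k with hG
  refine ⟨(d + B ^ 2 * η) / 2 * ‖x‖ ^ 2
      + β / 2 * ∑ k ∈ Icc 1 (t - 1), ⟪g k, x - w k⟫_ℝ ^ 2 + ⟪x, G⟫_ℝ,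
    (d + B ^ 2 * η) / 2 * (2 * ⟪x, u⟫_ℝ)
      + β / 2 * ∑ k ∈ Icc 1 (t - 1), 2 * ⟪g k, x - w k⟫_ℝ * ⟪g k, u⟫_ℝ + ⟪u, G⟫_ℝ,
    (d + B ^ 2 * η) / 2 * ‖u‖ ^ 2 + β / 2 * ∑ k ∈ Icc 1 (t - 1), ⟪g k, u⟫_ℝ ^ 2, ?_⟩
  funext s
  rw [Phi, Psi, hsum, hnorm, ← hG, inner_add_left, real_inner_smul_left,
    show 1 - (‖x‖ ^ 2 + 2 * ⟪x, u⟫_ℝ * s + ‖u‖ ^ 2 * s ^ 2) =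
      1 - ‖x‖ ^ 2 + -(2 * ⟪x, u⟫_ℝ) * s + -‖u‖ ^ 2 * s ^ 2 by ring]
  ring

/-- The Hessian of `Φ_t` dominates that of the barrier `Ψ`. -/
theorem qf_hessPsi_le_qf_hessPhi (d : ℕ) {η β : ℝ} (B : ℝ) (hη : 0 ≤ η) (hβ : 0 ≤ β)
    (g : ℕ → EuclideanSpace ℝ (Fin d)) (t : ℕ) (x u : EuclideanSpace ℝ (Fin d)) :
    qf (hessPsi d η x) u ≤ qf (hessPhi d η β B g t x) u := by
  rw [hessPhi, qf_add, qf_add, qf_smul, qf_smul, qf_sum, qf_one]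
  simp only [qf_outer]
  have h1 : 0 ≤ β * ∑ s ∈ Icc 1 (t - 1), ⟪g s, u⟫_ℝ ^ 2 := by positivity
  have h2 : 0 ≤ ((d : ℝ) + η * B ^ 2) * ‖u‖ ^ 2 := by positivity
  linarith

/-- `Φ_t` is infinitely differentiable on the open unit ball and is self-concordant with
constant `1/√(dη)`: `|D³Φ_t(x)[u,u,u]| ≤ (2/√(dη))·(uᵀ∇²Φ_t(x)u)^{3/2}`. -/
theorem Phi_smooth_and_self_concordant
    (d : ℕ) (hd : 1 ≤ d) (η β B : ℝ) (hη : 1 ≤ η) (hβ : β ∈ Set.Ioo (0 : ℝ) 1) (hB : 0 < B)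
    (T : ℕ) (hT : 1 ≤ T) (g w : ℕ → EuclideanSpace ℝ (Fin d))
    (hw : ∀ s ∈ Icc 1 T, ‖w s‖ < 1)
    (t : ℕ) (ht : t ∈ Icc 1 (T + 1)) :
    ContDiffOn ℝ (⊤ : ℕ∞) (Phi d η β B g w t) (Metric.ball (0 : EuclideanSpace ℝ (Fin d)) 1) ∧
      ∀ x ∈ Metric.ball (0 : EuclideanSpace ℝ (Fin d)) 1, ∀ u : EuclideanSpace ℝ (Fin d),
        |iteratedFDeriv ℝ 3 (Phi d η β B g w t) x ![u, u, u]| ≤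
          (2 / Real.sqrt (d * η)) * (qf (hessPhi d η β B g t x) u) ^ ((3 : ℝ) / 2) := by
  refine ⟨contDiffOn_Phi d η β B g w t _, fun x hx u => ?_⟩
  have hdη : 0 < (d : ℝ) * η := mul_pos (by exact_mod_cast hd) (by linarith)
  have hr : 0 < 1 - ‖x‖ ^ 2 := by
    have hx' : ‖x‖ < 1 := by simpa using hx
    nlinarith [norm_nonneg x]
  have hline : iteratedFDeriv ℝ 3 (Phi d η β B g w t) x ![u, u, u] =
      iteratedDeriv 3 (fun s : ℝ => Phi d η β B g w t (x + s • u)) 0 := by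
    rw [← iteratedFDeriv_diag_eq_iteratedDeriv_line Metric.isOpen_ball
      (contDiffOn_Phi d η β B g w t _) hx u]
    congr 1
    ext i
    fin_cases i <;> rfl
  obtain ⟨a, b, e, hPhi⟩ := exists_Phi_line_eq d η β B g w t x u
  rw [hline, hPhi, iteratedDeriv_three_neg_log_quadratic _ _ _ _ _ _ _ hr.ne']
  have hle := qf_hessPsi_le_qf_hessPhi d B (by linarith : (0 : ℝ) ≤ η) hβ.1.le g t x u
  rw [hessPsi, qf_add, qf_smul, qf_smul, qf_one, qf_outer] at hle
  have hbound := abs_cubic_le_rpow (y := 2 * ⟪x, u⟫_ℝ / (1 - ‖x‖ ^ 2))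
    (z := 2 * ‖u‖ ^ 2 / (1 - ‖x‖ ^ 2)) hdη (by positivity) (le_trans (le_of_eq ?_) hle)
  · refine le_trans (le_of_eq ?_) hbound
    congr 1
    ring
  · field_simp
    ring
end
end

section
/- Assume ‖g_s‖ ≤ B for all 1 ≤ s ≤ T. Then for every 1 ≤ t ≤ T and every y ∈ int B(1): g_tᵀ (∇²Φ_t(y))⁻¹ g_t ≤ 1/η. -/
open Finset
open scoped InnerProductSpace

noncomputable section

open Matrix in
/-- If `A` is positive semidefinite and `c > 0`, then `vᵀ (A + cI)⁻¹ v ≤ ‖v‖² / c`. -/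
theorem dotProduct_inv_add_smul_one_mulVec_le {n : Type*} [Fintype n] [DecidableEq n]
    {A : Matrix n n ℝ} (hA : A.PosSemidef) {c : ℝ} (hc : 0 < c) (v : n → ℝ) :
    v ⬝ᵥ ((A + c • (1 : Matrix n n ℝ))⁻¹ *ᵥ v) ≤ (v ⬝ᵥ v) / c := by
  have hpd : (A + c • (1 : Matrix n n ℝ)).PosDef :=
    PosDef.posSemidef_add hA (PosDef.one.smul hc)
  set M := A + c • (1 : Matrix n n ℝ) with hM
  set u := M⁻¹ *ᵥ v with hu
  have hMu : M *ᵥ u = v := by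
    rw [hu, mulVec_mulVec, mul_nonsing_inv _ hpd.det_pos.ne'.isUnit, one_mulVec]
  have hAu : 0 ≤ u ⬝ᵥ (A *ᵥ u) := by simpa using hA.dotProduct_mulVec_nonneg u
  have hquad : c * (u ⬝ᵥ u) ≤ v ⬝ᵥ u := by
    have h : v ⬝ᵥ u = u ⬝ᵥ (A *ᵥ u) + c * (u ⬝ᵥ u) := by
      conv_lhs => rw [← hMu, dotProduct_comm, hM]
      simp [add_mulVec, smul_mulVec]
    linarith
  have hsq : 0 ≤ (v - c • u) ⬝ᵥ (v - c • u) :=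
    Finset.sum_nonneg fun i _ => mul_self_nonneg _
  have hexp : (v - c • u) ⬝ᵥ (v - c • u)
      = v ⬝ᵥ v - 2 * c * (v ⬝ᵥ u) + c * (c * (u ⬝ᵥ u)) := by
    simp only [sub_dotProduct, dotProduct_sub, smul_dotProduct, dotProduct_smul, smul_eq_mul,
      dotProduct_comm u v]
    ring
  rw [le_div_iff₀ hc]
  nlinarith [mul_le_mul_of_nonneg_left hquad hc.le]

theorem outer_self_posSemidef {d : ℕ} (v : EuclideanSpace ℝ (Fin d)) :
    (outer v v).PosSemidef := by
  have h := Matrix.posSemidef_vecMulVec_self_star (v : Fin d → ℝ)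
  rw [star_trivial] at h
  exact h

theorem hessPsi_posSemidef (d : ℕ) {η : ℝ} (hη : 0 ≤ η) {x : EuclideanSpace ℝ (Fin d)}
    (hx : ‖x‖ < 1) : (hessPsi d η x).PosSemidef := by
  have h : 0 ≤ 1 - ‖x‖ ^ 2 := by nlinarith [norm_nonneg x]
  exact (Matrix.PosSemidef.one.smul (by positivity)).add
    ((outer_self_posSemidef x).smul (by positivity))

theorem qf_eq_dotProduct_mulVec {d : ℕ} (M : Matrix (Fin d) (Fin d) ℝ)
    (v : EuclideanSpace ℝ (Fin d)) : qf M v = v.ofLp ⬝ᵥ (M.mulVec v.ofLp) := by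
  simp only [qf, dotProduct, Matrix.mulVec, Finset.mul_sum, mul_assoc]

/-- If `‖g_s‖ ≤ B` for all `1 ≤ s ≤ T`, then for every `1 ≤ t ≤ T` and every `y` in the
open unit ball, `g_tᵀ (∇²Φ_t(y))⁻¹ g_t ≤ 1/η`. -/
theorem local_grad_norm_le
    (d : ℕ) (hd : 1 ≤ d) (η β B : ℝ) (hη : 1 ≤ η) (hβ : β ∈ Set.Ioo (0 : ℝ) 1) (hB : 0 < B)
    (T : ℕ) (hT : 1 ≤ T) (g w : ℕ → EuclideanSpace ℝ (Fin d))
    (hw : ∀ s ∈ Icc 1 T, ‖w s‖ < 1)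
    (hg : ∀ s ∈ Icc 1 T, ‖g s‖ ≤ B)
    (t : ℕ) (ht : t ∈ Icc 1 T)
    (y : EuclideanSpace ℝ (Fin d)) (hy : ‖y‖ < 1) :
    qf (hessPhi d η β B g t y)⁻¹ (g t) ≤ 1 / η := by
  have hη0 : 0 < η := one_pos.trans_le hη
  have hc : 0 < η * B ^ 2 := by positivity
  have hA : (hessPsi d η y + (d : ℝ) • (1 : Matrix (Fin d) (Fin d) ℝ)
      + β • ∑ s ∈ Icc 1 (t - 1), outer (g s) (g s)).PosSemidef :=
    ((hessPsi_posSemidef d hη0.le hy).add (Matrix.PosSemidef.one.smul d.cast_nonneg)).add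
      ((Matrix.posSemidef_sum _ fun s _ => outer_self_posSemidef (g s)).smul hβ.1.le)
  have hsplit : hessPhi d η β B g t y
      = hessPsi d η y + (d : ℝ) • (1 : Matrix (Fin d) (Fin d) ℝ)
        + β • ∑ s ∈ Icc 1 (t - 1), outer (g s) (g s)
        + (η * B ^ 2) • (1 : Matrix (Fin d) (Fin d) ℝ) := by
    rw [hessPhi, add_smul]
    abel
  have hnorm : (g t).ofLp ⬝ᵥ (g t).ofLp ≤ B ^ 2 := by
    have h : (g t).ofLp ⬝ᵥ (g t).ofLp = ‖g t‖ ^ 2 := by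
      rw [EuclideanSpace.real_norm_sq_eq]
      simp only [dotProduct, sq]
    rw [h]
    gcongr
    exact hg t ht
  rw [qf_eq_dotProduct_mulVec, hsplit]
  calc _ ≤ ((g t).ofLp ⬝ᵥ (g t).ofLp) / (η * B ^ 2) :=
        dotProduct_inv_add_smul_one_mulVec_le hA hc _
    _ ≤ B ^ 2 / (η * B ^ 2) := by gcongr
    _ = 1 / η := by field_simp
end
end

section
/- Assume ‖g_s‖ ≤ B for all 1 ≤ s ≤ T, and let 1 ≤ t ≤ T+1. Then Φ_t attains its minimum over int B(1) at a unique point x_t, and this minimizer satisfies 2ηd/(1−‖x_t‖²) ≤ 2·(2ηd + B²η + (B + 2βB²)(t−1)). -/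
open Finset
open scoped InnerProductSpace

noncomputable section

theorem half_log_add_log_le {u v : ℝ} (hu : 0 < u) (hv : 0 < v) :
    (Real.log u + Real.log v) / 2 ≤ Real.log ((u + v) / 2) := by
  have h := strictConcaveOn_log_Ioi.concaveOn.2 (Set.mem_Ioi.2 hu) (Set.mem_Ioi.2 hv)
    (by norm_num : (0 : ℝ) ≤ 1 / 2) (by norm_num : (0 : ℝ) ≤ 1 / 2) (by norm_num)
  simp only [smul_eq_mul] at h
  rw [show (u + v) / 2 = 1 / 2 * u + 1 / 2 * v by ring]
  linarith

theorem one_sub_norm_sq_pos {E : Type*} [SeminormedAddCommGroup E] {x : E}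
    (hx : x ∈ Metric.ball (0 : E) 1) : 0 < 1 - ‖x‖ ^ 2 := by
  rw [mem_ball_zero_iff] at hx
  nlinarith [norm_nonneg x]

theorem norm_sq_midpoint {E : Type*} [NormedAddCommGroup E] [InnerProductSpace ℝ E] (x y : E) :
    ‖(1 / 2 : ℝ) • (x + y)‖ ^ 2 = (‖x‖ ^ 2 + ‖y‖ ^ 2) / 2 - ‖x - y‖ ^ 2 / 4 := by
  rw [norm_smul, mul_pow, norm_add_sq_real, norm_sub_sq_real]
  norm_num
  ring

theorem Psi_midpoint_le {d : ℕ} {η : ℝ} (hη : 0 ≤ η) {x y : EuclideanSpace ℝ (Fin d)}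
    (hx : x ∈ Metric.ball (0 : EuclideanSpace ℝ (Fin d)) 1)
    (hy : y ∈ Metric.ball (0 : EuclideanSpace ℝ (Fin d)) 1) :
    Psi d η ((1 / 2 : ℝ) • (x + y)) ≤ (Psi d η x + Psi d η y) / 2 := by
  have hu := one_sub_norm_sq_pos hx
  have hv := one_sub_norm_sq_pos hy
  have h1 := half_log_add_log_le hu hv
  have h2 : Real.log ((1 - ‖x‖ ^ 2 + (1 - ‖y‖ ^ 2)) / 2)
      ≤ Real.log (1 - ‖(1 / 2 : ℝ) • (x + y)‖ ^ 2) := by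
    apply Real.log_le_log (by linarith)
    rw [norm_sq_midpoint]
    nlinarith [sq_nonneg ‖x - y‖]
  have h3 := mul_le_mul_of_nonneg_left (h1.trans h2) (by positivity : 0 ≤ η * d)
  unfold Psi
  linarith

theorem Phi_midpoint_le {d : ℕ} {η β B : ℝ} (hη : 0 ≤ η) (hβ : 0 ≤ β)
    (g w : ℕ → EuclideanSpace ℝ (Fin d)) (t : ℕ) {x y : EuclideanSpace ℝ (Fin d)}
    (hx : x ∈ Metric.ball (0 : EuclideanSpace ℝ (Fin d)) 1)
    (hy : y ∈ Metric.ball (0 : EuclideanSpace ℝ (Fin d)) 1) :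
    Phi d η β B g w t ((1 / 2 : ℝ) • (x + y)) + (d + B ^ 2 * η) / 8 * ‖x - y‖ ^ 2
      ≤ (Phi d η β B g w t x + Phi d η β B g w t y) / 2 := by
  have h1 := Psi_midpoint_le hη hx hy
  have h2 : ∑ s ∈ Icc 1 (t - 1), ⟪g s, (1 / 2 : ℝ) • (x + y) - w s⟫_ℝ ^ 2 ≤
      (∑ s ∈ Icc 1 (t - 1), ⟪g s, x - w s⟫_ℝ ^ 2
        + ∑ s ∈ Icc 1 (t - 1), ⟪g s, y - w s⟫_ℝ ^ 2) / 2 := by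
    rw [← sum_add_distrib, sum_div]
    refine sum_le_sum fun s _ => ?_
    simp only [inner_sub_right, inner_smul_right, inner_add_right]
    nlinarith [sq_nonneg (⟪g s, x⟫_ℝ - ⟪g s, y⟫_ℝ)]
  have h3 := mul_le_mul_of_nonneg_left h2 (by positivity : 0 ≤ β / 2)
  unfold Phi
  rw [norm_sq_midpoint, real_inner_smul_left, inner_add_left]
  linarith

theorem eq_of_isMinOn_Phi {d : ℕ} (hd : 1 ≤ d) {η β B : ℝ} (hη : 0 ≤ η) (hβ : 0 ≤ β)
    {g w : ℕ → EuclideanSpace ℝ (Fin d)} {t : ℕ} {x y : EuclideanSpace ℝ (Fin d)}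
    (hx : x ∈ Metric.ball (0 : EuclideanSpace ℝ (Fin d)) 1)
    (hy : y ∈ Metric.ball (0 : EuclideanSpace ℝ (Fin d)) 1)
    (hxmin : IsMinOn (Phi d η β B g w t) (Metric.ball (0 : EuclideanSpace ℝ (Fin d)) 1) x)
    (hymin : IsMinOn (Phi d η β B g w t) (Metric.ball (0 : EuclideanSpace ℝ (Fin d)) 1) y) :
    x = y := by
  have hz : (1 / 2 : ℝ) • (x + y) ∈ Metric.ball (0 : EuclideanSpace ℝ (Fin d)) 1 := by
    rw [smul_add]
    exact convex_ball 0 1 hx hy (by norm_num) (by norm_num) (by norm_num)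
  have h1 := isMinOn_iff.1 hxmin _ hz
  have h2 := isMinOn_iff.1 hymin _ hz
  have h3 := Phi_midpoint_le (B := B) hη hβ g w t hx hy
  have hd' : (1 : ℝ) ≤ d := by exact_mod_cast hd
  have hc : 0 < (d + B ^ 2 * η) / 8 := by positivity
  have h4 : ‖x - y‖ ^ 2 ≤ 0 := by
    by_contra! h
    have := mul_pos hc h
    linarith
  have h5 : ‖x - y‖ = 0 := by
    rw [← sq_eq_zero_iff]
    exact le_antisymm h4 (sq_nonneg _)
  exact sub_eq_zero.1 (norm_eq_zero.1 h5)

theorem continuousOn_Phi (d : ℕ) (η β B : ℝ) (g w : ℕ → EuclideanSpace ℝ (Fin d)) (t : ℕ) :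
    ContinuousOn (Phi d η β B g w t) (Metric.ball (0 : EuclideanSpace ℝ (Fin d)) 1) := by
  have h : ContinuousOn (Psi d η) (Metric.ball (0 : EuclideanSpace ℝ (Fin d)) 1) :=
    continuousOn_const.mul (ContinuousOn.log (by fun_prop) fun x hx => (one_sub_norm_sq_pos hx).ne')
  unfold Phi
  fun_prop

theorem exists_isMinOn_Phi {d : ℕ} (hd : 1 ≤ d) {η β : ℝ} (hη : 0 < η) (hβ : 0 ≤ β) (B : ℝ)
    (g w : ℕ → EuclideanSpace ℝ (Fin d)) (t : ℕ) :
    ∃ x ∈ Metric.ball (0 : EuclideanSpace ℝ (Fin d)) 1,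
      IsMinOn (Phi d η β B g w t) (Metric.ball (0 : EuclideanSpace ℝ (Fin d)) 1) x := by
  have hd' : (1 : ℝ) ≤ d := by exact_mod_cast hd
  set G : EuclideanSpace ℝ (Fin d) := ∑ s ∈ Icc 1 (t - 1), g s with hG
  set ε : ℝ := Real.exp (-((Phi d η β B g w t 0 + ‖G‖) / (η * d))) with hε
  have hεpos : 0 < ε := Real.exp_pos _
  have hηd : 0 < η * d := by positivity
  have hsub : ∀ x ∈ Metric.ball (0 : EuclideanSpace ℝ (Fin d)) 1,
      Phi d η β B g w t x ≤ Phi d η β B g w t 0 → ‖x‖ ^ 2 ≤ 1 - ε := by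
    intro x hx hle
    have hpos := one_sub_norm_sq_pos hx
    have hlow : Psi d η x - ‖G‖ ≤ Phi d η β B g w t x := by
      have h1 : 0 ≤ (d + B ^ 2 * η) / 2 * ‖x‖ ^ 2 := by positivity
      have h2 : 0 ≤ β / 2 * ∑ s ∈ Icc 1 (t - 1), ⟪g s, x - w s⟫_ℝ ^ 2 :=
        mul_nonneg (by positivity) (sum_nonneg fun s _ => sq_nonneg _)
      have h3 : -‖G‖ ≤ ⟪x, G⟫_ℝ := by
        have h4 := neg_le_of_abs_le (abs_real_inner_le_norm x G)
        have h5 := mem_ball_zero_iff.1 hx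
        nlinarith [norm_nonneg G]
      unfold Phi
      linarith
    have hlog : -((Phi d η β B g w t 0 + ‖G‖) / (η * d)) ≤ Real.log (1 - ‖x‖ ^ 2) := by
      rw [neg_le, le_div_iff₀ hηd]
      unfold Psi at hlow
      linarith
    have := (Real.le_log_iff_exp_le hpos).1 hlog
    linarith
  have h0 : (0 : EuclideanSpace ℝ (Fin d)) ∈ Metric.ball (0 : EuclideanSpace ℝ (Fin d)) 1 := by
    simp
  set K : Set (EuclideanSpace ℝ (Fin d)) := {x | ‖x‖ ^ 2 ≤ 1 - ε} with hK
  have hKball : K ⊆ Metric.ball 0 1 := by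
    intro x hx
    have hx' : ‖x‖ ^ 2 ≤ 1 - ε := hx
    rw [mem_ball_zero_iff]
    nlinarith [norm_nonneg x]
  have hKcompact : IsCompact K := by
    refine Metric.isCompact_of_isClosed_isBounded ?_ (Metric.isBounded_ball.subset hKball)
    exact isClosed_le (by fun_prop) continuous_const
  obtain ⟨x, hxK, hxmin⟩ := hKcompact.exists_isMinOn ⟨0, hsub 0 h0 le_rfl⟩
    ((continuousOn_Phi d η β B g w t).mono hKball)
  refine ⟨x, hKball hxK, isMinOn_iff.2 fun y hy => ?_⟩
  have hx0 := isMinOn_iff.1 hxmin 0 (hsub 0 h0 le_rfl)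
  rcases le_total (Phi d η β B g w t y) (Phi d η β B g w t 0) with h | h
  · exact isMinOn_iff.1 hxmin y (hsub y hy h)
  · exact hx0.trans h

theorem hasDerivAt_Phi_smul (d : ℕ) (η β B : ℝ) (g w : ℕ → EuclideanSpace ℝ (Fin d)) (t : ℕ)
    {x : EuclideanSpace ℝ (Fin d)} (hx : x ∈ Metric.ball (0 : EuclideanSpace ℝ (Fin d)) 1) :
    HasDerivAt (fun c : ℝ => Phi d η β B g w t (c • x))
      (2 * η * d * ‖x‖ ^ 2 / (1 - ‖x‖ ^ 2) + (d + B ^ 2 * η) * ‖x‖ ^ 2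
        + β * ∑ s ∈ Icc 1 (t - 1), ⟪g s, x - w s⟫_ℝ * ⟪g s, x⟫_ℝ
        + ⟪x, ∑ s ∈ Icc 1 (t - 1), g s⟫_ℝ) 1 := by
  have hpos := one_sub_norm_sq_pos hx
  have hsq : HasDerivAt (fun c : ℝ => ‖c • x‖ ^ 2) (2 * ‖x‖ ^ 2) 1 := by
    have h := ((hasDerivAt_id (1 : ℝ)).pow 2).mul_const (‖x‖ ^ 2)
    refine (h.congr_deriv (by simp)).congr_of_eventuallyEq (.of_forall fun c => ?_)
    simp [norm_smul, mul_pow]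
  have hlog := ((hsq.const_sub 1).log (by simpa using hpos.ne')).const_mul (-(η * d))
  have hquad : HasDerivAt (fun c : ℝ => ∑ s ∈ Icc 1 (t - 1), ⟪g s, c • x - w s⟫_ℝ ^ 2)
      (∑ s ∈ Icc 1 (t - 1), 2 * (⟪g s, x - w s⟫_ℝ * ⟪g s, x⟫_ℝ)) 1 := by
    refine HasDerivAt.fun_sum fun s _ => ?_
    have h := (((hasDerivAt_id (1 : ℝ)).mul_const ⟪g s, x⟫_ℝ).sub_const ⟪g s, w s⟫_ℝ).pow 2
    refine (h.congr_deriv ?_).congr_of_eventuallyEq (.of_forall fun c => ?_)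
    · simp [inner_sub_right]
      ring
    · simp [inner_sub_right, inner_smul_right]
  have hlin : HasDerivAt (fun c : ℝ => ⟪c • x, ∑ s ∈ Icc 1 (t - 1), g s⟫_ℝ)
      ⟪x, ∑ s ∈ Icc 1 (t - 1), g s⟫_ℝ 1 := by
    simp only [real_inner_smul_left]
    simpa using (hasDerivAt_id (1 : ℝ)).mul_const ⟪x, ∑ s ∈ Icc 1 (t - 1), g s⟫_ℝ
  refine (((hlog.add (hsq.const_mul ((d + B ^ 2 * η) / 2))).add
    (hquad.const_mul (β / 2))).add hlin).congr_deriv ?_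
  rw [one_smul, ← mul_sum]
  field_simp

theorem radial_deriv_eq_zero {d : ℕ} {η β B : ℝ} {g w : ℕ → EuclideanSpace ℝ (Fin d)} {t : ℕ}
    {x : EuclideanSpace ℝ (Fin d)} (hx : x ∈ Metric.ball (0 : EuclideanSpace ℝ (Fin d)) 1)
    (hmin : IsMinOn (Phi d η β B g w t) (Metric.ball (0 : EuclideanSpace ℝ (Fin d)) 1) x) :
    2 * η * d * ‖x‖ ^ 2 / (1 - ‖x‖ ^ 2) + (d + B ^ 2 * η) * ‖x‖ ^ 2
        + β * ∑ s ∈ Icc 1 (t - 1), ⟪g s, x - w s⟫_ℝ * ⟪g s, x⟫_ℝ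
        + ⟪x, ∑ s ∈ Icc 1 (t - 1), g s⟫_ℝ = 0 := by
  refine IsLocalMin.hasDerivAt_eq_zero ?_ (hasDerivAt_Phi_smul d η β B g w t hx)
  have hcont : ContinuousAt (fun c : ℝ => c • x) 1 := by fun_prop
  have hnhds : Metric.ball (0 : EuclideanSpace ℝ (Fin d)) 1 ∈ nhds ((1 : ℝ) • x) := by
    rw [one_smul]
    exact Metric.isOpen_ball.mem_nhds hx
  filter_upwards [hcont hnhds] with c hc
  rw [one_smul]
  exact isMinOn_iff.1 hmin _ hc

theorem barrier_le_of_isMinOn_Phi {d : ℕ} {η β B : ℝ} (hη : 0 ≤ η) (hβ : 0 ≤ β) (hB : 0 ≤ B)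
    {g w : ℕ → EuclideanSpace ℝ (Fin d)} {t : ℕ}
    (hw : ∀ s ∈ Icc 1 (t - 1), ‖w s‖ ≤ 1) (hg : ∀ s ∈ Icc 1 (t - 1), ‖g s‖ ≤ B)
    {x : EuclideanSpace ℝ (Fin d)} (hx : x ∈ Metric.ball (0 : EuclideanSpace ℝ (Fin d)) 1)
    (hmin : IsMinOn (Phi d η β B g w t) (Metric.ball (0 : EuclideanSpace ℝ (Fin d)) 1) x) :
    2 * η * d / (1 - ‖x‖ ^ 2) ≤ 2 * η * d + (B + 2 * β * B ^ 2) * ((t - 1 : ℕ) : ℝ) := by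
  have hpos := one_sub_norm_sq_pos hx
  have hx1 := (mem_ball_zero_iff.1 hx).le
  have hinner : ∀ s ∈ Icc 1 (t - 1), |⟪g s, x⟫_ℝ| ≤ B := fun s hs =>
    (abs_real_inner_le_norm _ _).trans <|
      (mul_le_mul (hg s hs) hx1 (norm_nonneg _) hB).trans_eq (mul_one B)
  have hterm : ∀ s ∈ Icc 1 (t - 1),
      -(B + 2 * β * B ^ 2) ≤ β * (⟪g s, x - w s⟫_ℝ * ⟪g s, x⟫_ℝ) + ⟪x, g s⟫_ℝ := by
    intro s hs
    have h1 := hinner s hs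
    have h2 : |⟪g s, x - w s⟫_ℝ| ≤ B * 2 :=
      (abs_real_inner_le_norm _ _).trans <| mul_le_mul (hg s hs)
        ((norm_sub_le _ _).trans (by linarith [hw s hs])) (norm_nonneg _) hB
    have h3 : |⟪g s, x - w s⟫_ℝ * ⟪g s, x⟫_ℝ| ≤ B * 2 * B := by
      rw [abs_mul]
      exact mul_le_mul h2 h1 (abs_nonneg _) (by positivity)
    have h4 := mul_le_mul_of_nonneg_left (neg_le_of_abs_le h3) hβ
    rw [real_inner_comm] at h1
    have h5 := neg_le_of_abs_le h1
    linarith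
  have hsum := sum_le_sum hterm
  rw [sum_const, Nat.card_Icc, Nat.add_sub_cancel, nsmul_eq_mul, sum_add_distrib, ← mul_sum,
    ← inner_sum] at hsum
  have hzero := radial_deriv_eq_zero hx hmin
  have hquad : 0 ≤ (d + B ^ 2 * η) * ‖x‖ ^ 2 := by positivity
  have hsplit : 2 * η * d / (1 - ‖x‖ ^ 2)
      = 2 * η * d + 2 * η * d * ‖x‖ ^ 2 / (1 - ‖x‖ ^ 2) := by
    field_simp
    ring
  linarith

/-- If `‖g_s‖ ≤ B` for all `1 ≤ s ≤ T` and `1 ≤ t ≤ T+1`, then `Φ_t` attains its minimum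
over the open unit ball at a unique point `x_t`, and this minimizer satisfies
`2ηd/(1−‖x_t‖²) ≤ 2·(2ηd + B²η + (B + 2βB²)(t−1))`. -/
theorem ftrl_minimizer_exists_unique_and_bound
    (d : ℕ) (hd : 1 ≤ d) (η β B : ℝ) (hη : 1 ≤ η) (hβ : β ∈ Set.Ioo (0 : ℝ) 1) (hB : 0 < B)
    (T : ℕ) (hT : 1 ≤ T) (g w : ℕ → EuclideanSpace ℝ (Fin d))
    (hw : ∀ s ∈ Icc 1 T, ‖w s‖ < 1)
    (hg : ∀ s ∈ Icc 1 T, ‖g s‖ ≤ B)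
    (t : ℕ) (ht : t ∈ Icc 1 (T + 1)) :
    ∃ x : EuclideanSpace ℝ (Fin d),
      x ∈ Metric.ball (0 : EuclideanSpace ℝ (Fin d)) 1 ∧
      IsMinOn (Phi d η β B g w t) (Metric.ball (0 : EuclideanSpace ℝ (Fin d)) 1) x ∧
      (∀ y ∈ Metric.ball (0 : EuclideanSpace ℝ (Fin d)) 1,
        IsMinOn (Phi d η β B g w t) (Metric.ball (0 : EuclideanSpace ℝ (Fin d)) 1) y → y = x) ∧
      2 * η * d / (1 - ‖x‖ ^ 2) ≤
        2 * (2 * η * d + B ^ 2 * η + (B + 2 * β * B ^ 2) * ((t : ℝ) - 1)) := by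
  obtain ⟨ht1, htT⟩ := mem_Icc.1 ht
  have hη0 : 0 < η := by linarith
  have hmem : ∀ s ∈ Icc 1 (t - 1), s ∈ Icc 1 T := fun s hs =>
    Icc_subset_Icc_right (by omega) hs
  obtain ⟨x, hx, hmin⟩ := exists_isMinOn_Phi hd hη0 hβ.1.le B g w t
  refine ⟨x, hx, hmin,
    fun y hy hymin => eq_of_isMinOn_Phi hd hη0.le hβ.1.le hy hx hymin hmin, ?_⟩
  have hbound := barrier_le_of_isMinOn_Phi hη0.le hβ.1.le hB.le
    (fun s hs => (hw s (hmem s hs)).le) (fun s hs => hg s (hmem s hs)) hx hmin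
  rw [Nat.cast_sub ht1, Nat.cast_one] at hbound
  have h1 : (0 : ℝ) ≤ (t : ℝ) - 1 := sub_nonneg.2 (by exact_mod_cast ht1)
  have hβ0 := hβ.1
  have h2 : 0 ≤ (B + 2 * β * B ^ 2) * ((t : ℝ) - 1) := by positivity
  have h3 : 0 ≤ B ^ 2 * η := by positivity
  have h4 : 0 ≤ 2 * η * d := by positivity
  linarith
end
end

section
/- Let c ∈ (0,1), S ≥ 0, T ≥ 2, and let w_1,…,w_T be points in the open Euclidean unit ball of ℝ^d. Define the landmark sequence u_1,…,u_T by u_1 = w_1 and, for 1 ≤ t ≤ T−1, u_{t+1} = u_t if |‖w_{t+1}‖² − ‖u_t‖²| ≤ c·(1−‖u_t‖²) and u_{t+1} = w_{t+1} otherwise. For 1 ≤ t ≤ T−1 set α_t = (‖w_{t+1}‖² − ‖w_t‖²)/(1−‖w_{t+1}‖²) and μ_t = (‖w_t‖² − ‖w_{t+1}‖²)/(1−‖w_t‖²). If Σ_{t=1}^{T−1} (α_t² + μ_t²) ≤ S, then the number of landmark updates satisfies #{ t ∈ {1,…,T−1} : u_{t+1} ≠ u_t } ≤ 1 + (4/c)·√(S·T).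 -/
open Finset
open scoped Classical

/-- Leaving the relative window of width `c` around `a` costs at least `c / 2` on the log scale. -/
theorem half_le_abs_log_sub_log {a b c : ℝ} (ha : 0 < a) (hb : 0 < b) (hc : 0 < c)
    (hc1 : c < 1) (h : c * a < |b - a|) : c / 2 ≤ |Real.log b - Real.log a| := by
  rcases lt_abs.1 h with h | h
  · refine le_trans ?_ (le_abs_self _)
    rw [← Real.log_div hb.ne' ha.ne']
    refine le_trans ?_ (Real.one_sub_inv_le_log_of_pos (div_pos hb ha))
    rw [inv_div, le_sub_iff_add_le, ← le_sub_iff_add_le', div_le_iff₀ hb]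
    nlinarith [mul_pos ha hc, mul_pos hc hc]
  · refine le_trans ?_ (neg_le_abs _)
    rw [neg_sub, ← Real.log_div ha.ne' hb.ne']
    refine le_trans ?_ (Real.one_sub_inv_le_log_of_pos (div_pos ha hb))
    rw [inv_div, le_sub_iff_add_le, ← le_sub_iff_add_le', div_le_iff₀ ha]
    nlinarith [mul_pos ha hc]

theorem log_sub_log_le_sub_div {a b : ℝ} (ha : 0 < a) (hb : 0 < b) :
    Real.log b - Real.log a ≤ (b - a) / a := by
  rw [← Real.log_div hb.ne' ha.ne', sub_div, div_self ha.ne']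
  exact Real.log_le_sub_one_of_pos (div_pos hb ha)

theorem sq_log_sub_log_le {a b : ℝ} (ha : 0 < a) (hb : 0 < b) :
    |Real.log b - Real.log a| ^ 2 ≤ ((a - b) / b) ^ 2 + ((b - a) / a) ^ 2 := by
  rw [sq_abs]
  have h1 := log_sub_log_le_sub_div ha hb
  have h2 := log_sub_log_le_sub_div hb ha
  rcases le_total 0 (Real.log b - Real.log a) with h | h
  · nlinarith [sq_nonneg ((a - b) / b)]
  · nlinarith [sq_nonneg ((b - a) / a)]

/-- Potential argument: the number of landmark updates, weighted by `c / 2`, plus the current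
log-distance to the landmark is bounded by the total variation of the logarithm. -/
theorem card_updates_add_abs_log_le {E : Type*} (f : E → ℝ) {c : ℝ} (hc : 0 < c) (hc1 : c < 1)
    (w u : ℕ → E) (n : ℕ) (hw : ∀ t ∈ Icc 1 (n + 1), 0 < f (w t)) (hu1 : u 1 = w 1)
    (hrec : ∀ t ∈ Icc 1 n,
      u (t + 1) = u t ∨ u (t + 1) = w (t + 1) ∧ c * f (u t) < |f (w (t + 1)) - f (u t)|) :
    0 < f (u (n + 1)) ∧
      (#{t ∈ Icc 1 n | u (t + 1) ≠ u t} : ℝ) * (c / 2) +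
        |Real.log (f (w (n + 1))) - Real.log (f (u (n + 1)))| ≤
      ∑ t ∈ Icc 1 n, |Real.log (f (w (t + 1))) - Real.log (f (w t))| := by
  induction n with
  | zero => simpa [hu1] using hw 1 (by simp)
  | succ n ih =>
    obtain ⟨hpos, hle⟩ := ih (fun t ht => hw t (by simp only [mem_Icc] at ht ⊢; omega))
      (fun t ht => hrec t (by simp only [mem_Icc] at ht ⊢; omega))
    have hwpos := hw (n + 1 + 1) (by simp)
    have htri := abs_sub_le (Real.log (f (w (n + 1 + 1)))) (Real.log (f (w (n + 1))))
      (Real.log (f (u (n + 1))))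
    rw [card_filter, Nat.cast_sum] at hle ⊢
    rw [sum_Icc_succ_top (by omega), sum_Icc_succ_top (by omega)]
    by_cases h : u (n + 1 + 1) = u (n + 1)
    · rw [h]
      refine ⟨hpos, ?_⟩
      simp only [ne_eq, not_true_eq_false, if_false, Nat.cast_zero, add_zero] at hle ⊢
      linarith
    · obtain ⟨hu, hjump⟩ := (hrec (n + 1) (by simp)).resolve_left h
      have hlog := half_le_abs_log_sub_log hpos hwpos hc hc1 hjump
      rw [if_pos h, hu, sub_self, abs_zero, Nat.cast_one]
      exact ⟨hwpos, by linarith⟩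

/-- Combinatorial core of the stability lemma: given iterates `w_1,…,w_T` in the open unit
ball, the landmark sequence `u_1 = w_1`, `u_{t+1} = u_t` if
`|‖w_{t+1}‖² − ‖u_t‖²| ≤ c(1−‖u_t‖²)` and `u_{t+1} = w_{t+1}` otherwise, with
`α_t = (‖w_{t+1}‖² − ‖w_t‖²)/(1−‖w_{t+1}‖²)` and `μ_t = (‖w_t‖² − ‖w_{t+1}‖²)/(1−‖w_t‖²)`,
satisfies: if `Σ_{t=1}^{T−1}(α_t² + μ_t²) ≤ S` then the number of landmark updates is at most
`1 + (4/c)·√(ST)`. -/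
theorem landmark_updates_card_le
    (d : ℕ) (c S : ℝ) (hc : c ∈ Set.Ioo (0 : ℝ) 1) (hS : 0 ≤ S)
    (T : ℕ) (hT : 2 ≤ T)
    (w u : ℕ → EuclideanSpace ℝ (Fin d))
    (hw : ∀ t ∈ Icc 1 T, ‖w t‖ < 1)
    (hu1 : u 1 = w 1)
    (hrec : ∀ t ∈ Icc 1 (T - 1),
      (|‖w (t + 1)‖ ^ 2 - ‖u t‖ ^ 2| ≤ c * (1 - ‖u t‖ ^ 2) → u (t + 1) = u t) ∧
      (¬ |‖w (t + 1)‖ ^ 2 - ‖u t‖ ^ 2| ≤ c * (1 - ‖u t‖ ^ 2) → u (t + 1) = w (t + 1)))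
    (α μ : ℕ → ℝ)
    (hα : ∀ t ∈ Icc 1 (T - 1), α t = (‖w (t + 1)‖ ^ 2 - ‖w t‖ ^ 2) / (1 - ‖w (t + 1)‖ ^ 2))
    (hμ : ∀ t ∈ Icc 1 (T - 1), μ t = (‖w t‖ ^ 2 - ‖w (t + 1)‖ ^ 2) / (1 - ‖w t‖ ^ 2))
    (hsum : ∑ t ∈ Icc 1 (T - 1), (α t ^ 2 + μ t ^ 2) ≤ S) :
    (((Icc 1 (T - 1)).filter fun t => u (t + 1) ≠ u t).card : ℝ) ≤
      1 + (4 / c) * Real.sqrt (S * T) := by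
  obtain ⟨hc0, hc1⟩ := hc
  obtain ⟨n, rfl⟩ : ∃ n, T = n + 1 := ⟨T - 1, by omega⟩
  rw [Nat.add_sub_cancel] at *
  have hpos : ∀ t ∈ Icc 1 (n + 1), 0 < 1 - ‖w t‖ ^ 2 := fun t ht => by
    nlinarith [hw t ht, norm_nonneg (w t)]
  have hmain := (card_updates_add_abs_log_le (fun x => 1 - ‖x‖ ^ 2) hc0 hc1 w u n hpos hu1
    fun t ht => by
      by_cases h : |‖w (t + 1)‖ ^ 2 - ‖u t‖ ^ 2| ≤ c * (1 - ‖u t‖ ^ 2)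
      · exact Or.inl ((hrec t ht).1 h)
      · refine Or.inr ⟨(hrec t ht).2 h, ?_⟩
        rw [sub_sub_sub_cancel_left, abs_sub_comm]
        exact not_le.1 h).2
  set x : ℕ → ℝ := fun t => |Real.log (1 - ‖w (t + 1)‖ ^ 2) - Real.log (1 - ‖w t‖ ^ 2)|
  have hsq : ∑ t ∈ Icc 1 n, x t ^ 2 ≤ S := by
    refine le_trans (sum_le_sum fun t ht => ?_) hsum
    have ht' := mem_Icc.1 ht
    have h := sq_log_sub_log_le (hpos t (mem_Icc.2 (by omega)))
      (hpos (t + 1) (mem_Icc.2 (by omega)))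
    rwa [sub_sub_sub_cancel_left, sub_sub_sub_cancel_left, ← hα t ht, ← hμ t ht] at h
  have hsum_x : ∑ t ∈ Icc 1 n, x t ≤ Real.sqrt (S * (n + 1 : ℕ)) := by
    apply Real.le_sqrt_of_sq_le
    have h := sq_sum_le_card_mul_sum_sq (s := Icc 1 n) (f := x)
    rw [Nat.card_Icc, Nat.add_sub_cancel] at h
    push_cast
    nlinarith [mul_le_mul_of_nonneg_left hsq (Nat.cast_nonneg (α := ℝ) n)]
  have hcard := (le_add_of_nonneg_right (abs_nonneg _)).trans (hmain.trans hsum_x)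
  rw [← le_div_iff₀ (by positivity)] at hcard
  refine le_trans (le_of_eq (by congr!)) (hcard.trans ?_)
  have hnonneg : 0 ≤ Real.sqrt (S * (n + 1 : ℕ)) / c := by positivity
  calc Real.sqrt (S * (n + 1 : ℕ)) / (c / 2) = 2 * (Real.sqrt (S * (n + 1 : ℕ)) / c) := by
        field_simp
    _ ≤ 1 + 4 * (Real.sqrt (S * (n + 1 : ℕ)) / c) := by linarith
    _ = 1 + (4 / c) * Real.sqrt (S * (n + 1 : ℕ)) := by ring
end

section
/- For each 1 ≤ t ≤ T+1 let x_t be the minimizer of Φ_t over int B(1). Then for every w ∈ int B(1): Σ_{t=1}^T ⟨x_{t+1} − w, g_t⟩ ≤ Ψ(w) + ((d+ηB²)/2)·‖w‖² + (β/2)·Σ_{t=1}^T ⟨g_t, w − w_t⟩². -/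
open Finset
open scoped InnerProductSpace

noncomputable section

theorem Psi_nonneg {d : ℕ} {η : ℝ} (hη : 0 ≤ η) {x : EuclideanSpace ℝ (Fin d)} (hx : ‖x‖ < 1) :
    0 ≤ Psi d η x := by
  have hlog : Real.log (1 - ‖x‖ ^ 2) ≤ 0 :=
    Real.log_nonpos (by nlinarith [norm_nonneg x]) (by nlinarith [sq_nonneg ‖x‖])
  exact mul_nonneg_of_nonpos_of_nonpos (neg_nonpos.2 (by positivity)) hlog

theorem Phi_one (d : ℕ) (η β B : ℝ) (g w : ℕ → EuclideanSpace ℝ (Fin d))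
    (x : EuclideanSpace ℝ (Fin d)) :
    Phi d η β B g w 1 x = Psi d η x + ((d + B ^ 2 * η) / 2) * ‖x‖ ^ 2 := by
  simp [Phi]

theorem Phi_succ (d : ℕ) (η β B : ℝ) (g w : ℕ → EuclideanSpace ℝ (Fin d)) (n : ℕ)
    (x : EuclideanSpace ℝ (Fin d)) :
    Phi d η β B g w (n + 2) x =
      Phi d η β B g w (n + 1) x + β / 2 * ⟪g (n + 1), x - w (n + 1)⟫_ℝ ^ 2
        + ⟪x, g (n + 1)⟫_ℝ := by
  simp only [Phi, Nat.add_sub_cancel, show n + 2 - 1 = n + 1 from rfl,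
    sum_Icc_succ_top (Nat.le_add_left 1 n), inner_add_right]
  ring

/-- The be-the-leader inequality, up to any round `n` at which the iterates still minimize. -/
theorem sum_inner_le_Phi {d : ℕ} {η β B : ℝ} (hη : 0 ≤ η) (hβ : 0 ≤ β)
    {g w x : ℕ → EuclideanSpace ℝ (Fin d)} (n : ℕ)
    (hx : ∀ t ∈ Icc 1 (n + 1),
      x t ∈ Metric.ball (0 : EuclideanSpace ℝ (Fin d)) 1 ∧
      IsMinOn (Phi d η β B g w t) (Metric.ball (0 : EuclideanSpace ℝ (Fin d)) 1) (x t)) :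
    ∑ t ∈ Icc 1 n, ⟪x (t + 1), g t⟫_ℝ ≤ Phi d η β B g w (n + 1) (x (n + 1)) := by
  induction n with
  | zero =>
    have h := Psi_nonneg hη (mem_ball_zero_iff.1 (hx 1 (by simp)).1)
    simp only [zero_add, Phi_one]
    simpa using add_nonneg h (by positivity : 0 ≤ ((d + B ^ 2 * η) / 2) * ‖x 1‖ ^ 2)
  | succ n ih =>
    have ih' := ih fun t ht => hx t (Icc_subset_Icc_right (by lia) ht)
    have hmin := isMinOn_iff.1 (hx (n + 1) (by simp)).2 _ (hx (n + 2) (by simp)).1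
    have hsq : 0 ≤ β / 2 * ⟪g (n + 1), x (n + 2) - w (n + 1)⟫_ℝ ^ 2 := by positivity
    rw [sum_Icc_succ_top (Nat.le_add_left 1 n), Phi_succ]
    linarith

/-- Be-the-leader bound for the FTRL iterates `x_t ∈ argmin_{int B(1)} Φ_t`: for every `w` in
the open unit ball,
`Σ_{t=1}^T ⟪x_{t+1} − w, g_t⟫ ≤ Ψ(w) + ((d+ηB²)/2)‖w‖² + (β/2)Σ_{t=1}^T ⟪g_t, w − w_t⟫²`. -/
theorem ftrl_be_the_leader_bound
    (d : ℕ) (hd : 1 ≤ d) (η β B : ℝ) (hη : 1 ≤ η) (hβ : β ∈ Set.Ioo (0 : ℝ) 1) (hB : 0 < B)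
    (T : ℕ) (hT : 1 ≤ T) (g w : ℕ → EuclideanSpace ℝ (Fin d))
    (hw : ∀ s ∈ Icc 1 T, ‖w s‖ < 1)
    (x : ℕ → EuclideanSpace ℝ (Fin d))
    (hx : ∀ t ∈ Icc 1 (T + 1),
      x t ∈ Metric.ball (0 : EuclideanSpace ℝ (Fin d)) 1 ∧
      IsMinOn (Phi d η β B g w t) (Metric.ball (0 : EuclideanSpace ℝ (Fin d)) 1) (x t)) :
    ∀ w' : EuclideanSpace ℝ (Fin d), ‖w'‖ < 1 →
      ∑ t ∈ Icc 1 T, ⟪x (t + 1) - w', g t⟫_ℝ ≤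
        Psi d η w' + ((d + η * B ^ 2) / 2) * ‖w'‖ ^ 2
          + β / 2 * ∑ t ∈ Icc 1 T, ⟪g t, w' - w t⟫_ℝ ^ 2 := by
  intro w' hw'
  have hlead := sum_inner_le_Phi (by linarith) hβ.1.le T hx
  have hmin := isMinOn_iff.1 (hx (T + 1) (by simp)).2 w' (mem_ball_zero_iff.2 hw')
  have hle := hlead.trans hmin
  simp only [Phi, Nat.add_sub_cancel, inner_sum] at hle
  simp only [inner_sub_left, sum_sub_distrib]
  linarith
end
end

section
/- Let C ⊆ ℝ^d be a closed convex set that is centrally symmetric (C = −C), contains 0 in its interior, and satisfies C ⊆ B(1). Let w ∈ B(1), let ν ∈ C° satisfy ⟨ν, w⟩ = γ_C(w), and set u = w if γ_C(w) < 1 and u = w/γ_C(w) otherwise. Let ζ ∈ ℝ^d with ‖ζ‖ ≤ 1, let s ∈ {0,1}, and set g = ζ − s·⟨ζ, u⟩·ν. Then |⟨g, w⟩| ≤ 2·|⟨ζ, w⟩|, and for every x ∈ C: |⟨g, w − x⟩| ≤ 4. -/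
open Finset
open scoped InnerProductSpace

noncomputable section

/-- The polar set `K° = { x : ⟪x, y⟫ ≤ 1 for all y ∈ K }` of a set in `ℝ^d`. -/
def polarSet {d : ℕ} (K : Set (EuclideanSpace ℝ (Fin d))) : Set (EuclideanSpace ℝ (Fin d)) :=
  {x | ∀ y ∈ K, ⟪x, y⟫_ℝ ≤ 1}

/-- Boundedness of the surrogate gradients of the gauge-based reduction: for a closed convex
centrally-symmetric set `C ⊆ B(1)` with `0` in its interior, `w ∈ B(1)`, `ν ∈ C°` with
`⟪ν, w⟫ = γ_C(w)`, `u = w` if `γ_C(w) < 1` and `u = w/γ_C(w)` otherwise, `‖ζ‖ ≤ 1`,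
`s ∈ {0,1}` and `g = ζ − s⟪ζ, u⟫ν`, one has `|⟪g, w⟫| ≤ 2|⟪ζ, w⟫|` and `|⟪g, w − x⟫| ≤ 4`
for every `x ∈ C`. -/
theorem gauge_reduction_gradient_bounds
    (d : ℕ) (C : Set (EuclideanSpace ℝ (Fin d)))
    (hclosed : IsClosed C) (hconv : Convex ℝ C) (hsym : C = -C)
    (h0 : (0 : EuclideanSpace ℝ (Fin d)) ∈ interior C)
    (hsub : C ⊆ Metric.closedBall (0 : EuclideanSpace ℝ (Fin d)) 1)
    (w : EuclideanSpace ℝ (Fin d)) (hw : ‖w‖ ≤ 1)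
    (ν : EuclideanSpace ℝ (Fin d)) (hν : ν ∈ polarSet C)
    (hνw : ⟪ν, w⟫_ℝ = gauge C w)
    (u : EuclideanSpace ℝ (Fin d))
    (hu : u = if gauge C w < 1 then w else (gauge C w)⁻¹ • w)
    (ζ : EuclideanSpace ℝ (Fin d)) (hζ : ‖ζ‖ ≤ 1)
    (s : ℝ) (hs : s = 0 ∨ s = 1)
    (g : EuclideanSpace ℝ (Fin d)) (hgdef : g = ζ - (s * ⟪ζ, u⟫_ℝ) • ν) :
    |⟪g, w⟫_ℝ| ≤ 2 * |⟪ζ, w⟫_ℝ| ∧ ∀ x ∈ C, |⟪g, w - x⟫_ℝ| ≤ 4 := by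
  set γ := gauge C w with hγ
  have hγ0 : 0 ≤ γ := gauge_nonneg w
  have hu1 : ‖u‖ ≤ 1 := by
    rw [hu]
    split_ifs with h
    · exact hw
    · have h1 : 1 ≤ γ := not_lt.mp h
      rw [norm_smul, norm_inv, Real.norm_of_nonneg hγ0]
      exact mul_le_one₀ (inv_le_one_of_one_le₀ h1) (norm_nonneg w) hw
  have inner_le : ∀ y : EuclideanSpace ℝ (Fin d), ‖y‖ ≤ 1 → |⟪ζ, y⟫_ℝ| ≤ 1 := fun y hy =>
    (abs_real_inner_le_norm ζ y).trans (mul_le_one₀ hζ (norm_nonneg y) hy)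
  have hs1 : |s| ≤ 1 := by rcases hs with rfl | rfl <;> simp
  have hgy : ∀ y, ⟪g, y⟫_ℝ = ⟪ζ, y⟫_ℝ - s * ⟪ζ, u⟫_ℝ * ⟪ν, y⟫_ℝ := fun y => by
    rw [hgdef, inner_sub_left, real_inner_smul_left]
  have hgw : |⟪g, w⟫_ℝ| ≤ 2 * |⟪ζ, w⟫_ℝ| := by
    have key : ∃ c : ℝ, |c| ≤ 1 ∧ ⟪g, w⟫_ℝ = c * ⟪ζ, w⟫_ℝ := by
      rw [hgy, hνw, hu]
      split_ifs with h
      · refine ⟨1 - s * γ, ?_, by ring⟩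
        rcases hs with rfl | rfl <;> rw [abs_le] <;> constructor <;> linarith
      · have h1 : γ ≠ 0 := by linarith [not_lt.mp h]
        refine ⟨1 - s, ?_, ?_⟩
        · rcases hs with rfl | rfl <;> norm_num
        · rw [real_inner_smul_right]
          field_simp
    obtain ⟨c, hc, hcw⟩ := key
    rw [hcw, abs_mul]
    gcongr
    linarith
  refine ⟨hgw, fun x hx => ?_⟩
  have hνx : |⟪ν, x⟫_ℝ| ≤ 1 := by
    have hneg : -x ∈ C := by
      rw [hsym]
      simpa using hx
    have h1 := hν x hx
    have h2 := hν (-x) hneg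
    rw [inner_neg_right] at h2
    exact abs_le.mpr ⟨by linarith, h1⟩
  have hgx : |⟪g, x⟫_ℝ| ≤ 2 := by
    have hprod : |s * ⟪ζ, u⟫_ℝ * ⟪ν, x⟫_ℝ| ≤ 1 := by
      rw [abs_mul, abs_mul]
      exact mul_le_one₀ (mul_le_one₀ hs1 (abs_nonneg _) (inner_le u hu1)) (abs_nonneg _) hνx
    rw [hgy]
    linarith [abs_sub ⟪ζ, x⟫_ℝ (s * ⟪ζ, u⟫_ℝ * ⟪ν, x⟫_ℝ),
      inner_le x (by simpa using hsub hx)]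
  rw [inner_sub_right]
  linarith [abs_sub ⟪g, w⟫_ℝ ⟪g, x⟫_ℝ, inner_le w hw]
end
end

section
/- Let d ≥ 1, T ≥ 1, η ≥ 1, β > 0, B > 0, and let C ⊆ B(1) be a convex set with 0 ∈ C. Let f_1,…,f_T : C → ℝ be convex and 1-Lipschitz (with respect to the Euclidean norm), and let u_t ∈ C, w_t ∈ ℝ^d, g_t ∈ ℝ^d (1 ≤ t ≤ T) satisfy: (i) for every t and every w ∈ C: f_t(u_t) − f_t(w) ≤ ⟨g_t, w_t − w⟩ − (β/2)·⟨g_t, w_t − w⟩²; and (ii) for every w in the open unit ball: Σ_{t=1}^T ( ⟨w_t − w, g_t⟩ − (β/2)⟨w_t − w, g_t⟩² ) ≤ Ψ(w) + ((d+ηB²)/2)·‖w‖² + ((3d + B√d)/β)·ln(d + B²T/d), where Ψ(w) = −ηd·ln(1−‖w‖²). Then for every w ∈ C: Σ_{t=1}^T ( f_t(u_t) − f_t(w) ) ≤ 1 + ηd·ln T + (d+ηB²)/2 + ((3d + B√d)/β)·ln(d + B²T/d). -/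
open Finset
open scoped InnerProductSpace

noncomputable section

/-- On the ball of radius `1 - 1/T` the barrier is at most `ηd·ln T`. -/
theorem Psi_le_log_of_norm_le {d : ℕ} {η T : ℝ} (hη : 0 ≤ η) (hT : 1 ≤ T)
    {x : EuclideanSpace ℝ (Fin d)} (hx : ‖x‖ ≤ 1 - 1 / T) :
    Psi d η x ≤ η * d * Real.log T := by
  have hT0 : 0 < T := by linarith
  have hinv : 0 < 1 / T := by positivity
  have hsq : 1 / T ≤ 1 - ‖x‖ ^ 2 := by nlinarith [norm_nonneg x]
  have hlog : -Real.log T ≤ Real.log (1 - ‖x‖ ^ 2) := by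
    simpa [Real.log_inv] using Real.log_le_log hinv hsq
  have hηd : 0 ≤ η * d := by positivity
  unfold Psi
  nlinarith [mul_le_mul_of_nonneg_left hlog hηd]

/-- Regret of the reduction on a general convex set `C ⊆ B(1)`: if the per-round regret of
`f_t` on `C` is dominated by the surrogate linear-quadratic regret of the inner iterates
(hypothesis (i)), and the inner subroutine enjoys the surrogate regret bound on the open unit
ball (hypothesis (ii)), then for every comparator `w ∈ C`,
`Σ_{t=1}^T (f_t(u_t) − f_t(w)) ≤ 1 + ηd·ln T + (d+ηB²)/2 + ((3d + B√d)/β)·ln(d + B²T/d)`. -/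
theorem reduction_regret_general_set
    (d T : ℕ) (hd : 1 ≤ d) (hT : 1 ≤ T) (η β B : ℝ)
    (hη : 1 ≤ η) (hβ : 0 < β) (hB : 0 < B)
    (C : Set (EuclideanSpace ℝ (Fin d))) (hCconv : Convex ℝ C)
    (hC0 : (0 : EuclideanSpace ℝ (Fin d)) ∈ C)
    (hCsub : C ⊆ Metric.closedBall (0 : EuclideanSpace ℝ (Fin d)) 1)
    (f : ℕ → EuclideanSpace ℝ (Fin d) → ℝ)
    (hconv : ∀ t ∈ Icc 1 T, ConvexOn ℝ C (f t))
    (hlip : ∀ t ∈ Icc 1 T, LipschitzOnWith 1 (f t) C)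
    (u w g : ℕ → EuclideanSpace ℝ (Fin d))
    (huC : ∀ t ∈ Icc 1 T, u t ∈ C)
    (h1 : ∀ t ∈ Icc 1 T, ∀ x ∈ C,
      f t (u t) - f t x ≤ ⟪g t, w t - x⟫_ℝ - β / 2 * ⟪g t, w t - x⟫_ℝ ^ 2)
    (h2 : ∀ x : EuclideanSpace ℝ (Fin d), ‖x‖ < 1 →
      ∑ t ∈ Icc 1 T, (⟪w t - x, g t⟫_ℝ - β / 2 * ⟪w t - x, g t⟫_ℝ ^ 2) ≤
        Psi d η x + ((d + η * B ^ 2) / 2) * ‖x‖ ^ 2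
          + (3 * d + B * Real.sqrt d) / β * Real.log (d + B ^ 2 * T / d)) :
    ∀ x ∈ C, ∑ t ∈ Icc 1 T, (f t (u t) - f t x) ≤
      1 + η * d * Real.log T + (d + η * B ^ 2) / 2
        + (3 * d + B * Real.sqrt d) / β * Real.log (d + B ^ 2 * T / d) := by
  intro x hx
  have hT1 : (1 : ℝ) ≤ T := by exact_mod_cast hT
  have hT0 : (0 : ℝ) < T := by linarith
  have hinv : 0 < 1 / (T : ℝ) := by positivity
  have hinv1 : 1 / (T : ℝ) ≤ 1 := by rw [div_le_one hT0]; exact hT1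
  have hx1 : ‖x‖ ≤ 1 := by simpa using hCsub hx
  set y := (1 - 1 / (T : ℝ)) • x with hy
  have hyC : y ∈ C := hCconv.smul_mem_of_zero_mem hC0 hx ⟨by linarith, by linarith⟩
  have hynorm : ‖y‖ ≤ 1 - 1 / (T : ℝ) := by
    rw [hy, norm_smul, Real.norm_of_nonneg (by linarith)]
    nlinarith
  have hdist : dist y x ≤ 1 / (T : ℝ) := by
    have hsub : y - x = -((1 / (T : ℝ)) • x) := by rw [hy]; module
    rw [dist_eq_norm, hsub, norm_neg, norm_smul, Real.norm_of_nonneg hinv.le]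
    nlinarith
  have hround : ∀ t ∈ Icc 1 T, f t (u t) - f t x ≤
      (⟪w t - y, g t⟫_ℝ - β / 2 * ⟪w t - y, g t⟫_ℝ ^ 2) + 1 / (T : ℝ) := by
    intro t ht
    have hreg := h1 t ht y hyC
    have hf := (hlip t ht).dist_le_mul y hyC x hx
    rw [Real.dist_eq, NNReal.coe_one, one_mul] at hf
    rw [real_inner_comm] at hreg
    linarith [le_abs_self (f t y - f t x)]
  have hsum := Finset.sum_le_sum hround
  rw [Finset.sum_add_distrib, Finset.sum_const, Nat.card_Icc, Nat.add_sub_cancel, nsmul_eq_mul,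
    mul_one_div_cancel hT0.ne'] at hsum
  have hinner := h2 y (by linarith)
  have hPsi := Psi_le_log_of_norm_le (by linarith : (0 : ℝ) ≤ η) hT1 hynorm
  have hquad : (d + η * B ^ 2) / 2 * ‖y‖ ^ 2 ≤ (d + η * B ^ 2) / 2 :=
    mul_le_of_le_one_right (by positivity)
      (pow_le_one₀ (norm_nonneg y) (by linarith))
  linarith
end
end
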